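/- Let (s,a) be a state-action pair of a finite Markov decision process and let π be a stationary policy with π(s) = a. For any horizon d ≥ 1, let N := Σ_{h=1}^d I[(s_h,a_h) = (s,a)] be the random number of visits to (s,a) in the first d steps of the trajectory following π under P started from s_1 = s. Then Pr[ N ≥ (1/4) · W^π_d(1_{s,a}, P, 1_s) ] ≥ 1/2. -/

import Mathlib

open scoped Classical BigOperators

/-- Probability of the trajectory `(s_1, …, s_d) = (t 0, …, t (d-1))` under the stationary
policy `π`, the transition kernel `P`, and the initial distribution `μ`. -/
noncomputable def trajProb {S A : Type*} (P : S → A → S → ℝ) (π : S → A) (μ : S → ℝ)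
    (d : ℕ) (t : Fin d → S) : ℝ :=
  (if h : 0 < d then μ (t ⟨0, h⟩) else 1) *
    ∏ i : Fin d,
      if h : (i : ℕ) + 1 < d then P (t i) (π (t i)) (t ⟨(i : ℕ) + 1, h⟩) else 1

/-- Number of visits of the trajectory `t` to the state-action pair `(s, a)` under the
stationary policy `π`. -/
noncomputable def visitCount {S A : Type*} (π : S → A) (s : S) (a : A) (d : ℕ)
    (t : Fin d → S) : ℕ :=
  (Finset.univ.filter fun i : Fin d => t i = s ∧ π (t i) = a).card

/-- `W_d^π(1_{s,a}, P, μ)`: the expected number of visits to `(s,a)` in `d` steps. -/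
noncomputable def expVisits {S A : Type*} [Fintype S] (P : S → A → S → ℝ) (π : S → A)
    (μ : S → ℝ) (s : S) (a : A) (d : ℕ) : ℝ :=
  ∑ t : Fin d → S, trajProb P π μ d t * (visitCount π s a d t : ℝ)

/-- Expectation of `f N`, where `N` is the total weight `∑ b (x_h)` collected in the first `d`
states of the Markov chain with kernel `Q` started from `x`. -/
noncomputable def chainExp {S : Type*} [Fintype S] (Q : S → S → ℝ) (b : S → ℕ) :
    ℕ → S → (ℕ → ℝ) → ℝ
  | 0, _, f => f 0
  | d + 1, x, f => ∑ y, Q x y * chainExp Q b d y (fun n => f (n + b x))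

section chainExp

variable {S : Type*} [Fintype S] {Q : S → S → ℝ} (b : S → ℕ)

theorem chainExp_mono (hQ0 : ∀ x y, 0 ≤ Q x y) (d : ℕ) (x : S) {f g : ℕ → ℝ}
    (h : ∀ n, f n ≤ g n) : chainExp Q b d x f ≤ chainExp Q b d x g := by
  induction d generalizing x f g with
  | zero => exact h 0
  | succ d ih =>
    exact Finset.sum_le_sum fun y _ =>
      mul_le_mul_of_nonneg_left (ih y fun n => h _) (hQ0 x y)

theorem chainExp_const (hQ1 : ∀ x, ∑ y, Q x y = 1) (d : ℕ) (x : S) (c : ℝ) :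
    chainExp Q b d x (fun _ => c) = c := by
  induction d generalizing x with
  | zero => rfl
  | succ d ih => simp [chainExp, ih, ← Finset.sum_mul, hQ1]

theorem chainExp_add (d : ℕ) (x : S) (f g : ℕ → ℝ) :
    chainExp Q b d x (fun n => f n + g n) = chainExp Q b d x f + chainExp Q b d x g := by
  induction d generalizing x f g with
  | zero => rfl
  | succ d ih =>
    simp only [chainExp, ← Finset.sum_add_distrib, ← mul_add]
    exact Finset.sum_congr rfl fun y _ => by rw [ih y (fun n => f (n + b x))]

theorem chainExp_le_succ (hQ0 : ∀ x y, 0 ≤ Q x y) (hQ1 : ∀ x, ∑ y, Q x y = 1) (d : ℕ) (x : S)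
    {f : ℕ → ℝ} (hf : Monotone f) : chainExp Q b d x f ≤ chainExp Q b (d + 1) x f := by
  induction d generalizing x f with
  | zero =>
    simp only [chainExp, ← Finset.sum_mul, hQ1, one_mul]
    exact hf (Nat.zero_le _)
  | succ d ih =>
    rw [chainExp, chainExp]
    exact Finset.sum_le_sum fun y _ =>
      mul_le_mul_of_nonneg_left (ih y fun m n h => hf (Nat.add_le_add_right h _)) (hQ0 x y)

/-- Restarting the chain at the visit number `k + 1` bounds the expected excess over `k`. -/
theorem chainExp_sub_le (hQ0 : ∀ x y, 0 ≤ Q x y) (hQ1 : ∀ x, ∑ y, Q x y = 1) {s : S}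
    (hb : ∀ x, b x = 0 ∨ x = s ∧ b x = 1) (d : ℕ) (W : ℝ)
    (hW : chainExp Q b d s (fun n => (n : ℝ)) ≤ W) (k : ℕ) (x : S) :
    chainExp Q b d x (fun n => ((n - k : ℕ) : ℝ)) ≤
      chainExp Q b d x (fun n => if k + 1 ≤ n then 1 else 0) * W := by
  induction d generalizing k x with
  | zero => simp [chainExp]
  | succ d ih =>
    have hWd := (chainExp_le_succ b hQ0 hQ1 d s Nat.mono_cast).trans hW
    have step (l : ℕ) : ∑ y, Q x y * chainExp Q b d y (fun n => ((n - l : ℕ) : ℝ)) ≤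
        (∑ y, Q x y * chainExp Q b d y (fun n => if l + 1 ≤ n then 1 else 0)) * W := by
      rw [Finset.sum_mul]
      refine Finset.sum_le_sum fun y _ => ?_
      rw [mul_assoc]
      exact mul_le_mul_of_nonneg_left (ih hWd l y) (hQ0 x y)
    rcases hb x with h | ⟨rfl, h⟩
    · simpa only [chainExp, h, add_zero] using step k
    · cases k with
      | zero =>
        have : chainExp Q b (d + 1) x (fun n => if 0 + 1 ≤ n then 1 else 0) = 1 := by
          simp [chainExp, h, chainExp_const b hQ1, hQ1]
        rw [this, one_mul]
        simpa using hW
      | succ k =>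
        simpa only [chainExp, h, Nat.add_sub_add_right, Nat.add_le_add_iff_right] using step k

end chainExp

theorem trajProb_cons {S A : Type*} (P : S → A → S → ℝ) (π : S → A) (μ : S → ℝ) (d : ℕ) (y : S)
    (t : Fin d → S) :
    trajProb P π μ (d + 1) (Fin.cons y t) = μ y * trajProb P π (P y (π y)) d t := by
  rw [trajProb, trajProb, Fin.prod_univ_succ]
  congr 1
  congr 1
  · by_cases h : 0 < d
    · simp only [Fin.val_zero, Nat.add_lt_add_iff_right, h, dite_true, Fin.cons_zero]
      exact congrArg (P y (π y)) (Fin.cons_succ (α := fun _ => S) y t ⟨0, h⟩)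
    · simp [h]
  · refine Finset.prod_congr rfl fun i _ => ?_
    by_cases h : (i : ℕ) + 1 < d
    · simp only [Fin.val_succ, Nat.add_lt_add_iff_right, h, dite_true, Fin.cons_succ]
      exact congrArg (P (t i) (π (t i))) (Fin.cons_succ (α := fun _ => S) y t ⟨i + 1, h⟩)
    · simp [h]

theorem visitCount_cons {S A : Type*} (π : S → A) (s : S) (a : A) (d : ℕ) (y : S)
    (t : Fin d → S) :
    visitCount π s a (d + 1) (Fin.cons y t) =
      visitCount π s a d t + if y = s ∧ π y = a then 1 else 0 := by
  simp only [visitCount, Finset.card_filter, Fin.sum_univ_succ, Fin.cons_zero, Fin.cons_succ]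
  rw [add_comm]

theorem sum_trajProb_mul {S A : Type*} [Fintype S] (P : S → A → S → ℝ)
    (hP1 : ∀ s a, ∑ s' : S, P s a s' = 1) (π : S → A) (s : S) (a : A) (d : ℕ)
    (μ : S → ℝ) (hμ : ∑ y, μ y = 1) (f : ℕ → ℝ) :
    ∑ t : Fin d → S, trajProb P π μ d t * f (visitCount π s a d t) =
      ∑ y, μ y * chainExp (fun x => P x (π x)) (fun x => if x = s ∧ π x = a then 1 else 0) d y f := by
  induction d generalizing μ f with
  | zero => simp [trajProb, visitCount, chainExp, ← Finset.sum_mul, hμ]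
  | succ d ih =>
    rw [← (Fin.consEquiv fun _ => S).sum_comp, Fintype.sum_prod_type]
    refine Finset.sum_congr rfl fun y _ => ?_
    change ∑ t : Fin d → S, trajProb P π μ (d + 1) (Fin.cons y t) *
      f (visitCount π s a (d + 1) (Fin.cons y t)) = _
    simp only [trajProb_cons, visitCount_cons, mul_assoc, ← Finset.mul_sum]
    rw [ih (P y (π y)) (hP1 _ _) (fun n => f (n + if y = s ∧ π y = a then 1 else 0)), chainExp]

/-- Concentration property of stationary policies: if `π` is stationary with `π(s) = a`,
then with probability at least `1/2`, the number `N` of visits to `(s,a)` in the first `d`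
steps starting from `s` satisfies `N ≥ (1/4)·W_d^π(1_{s,a}, P, 1_s)`. -/
theorem stationary_concentration {S A : Type*} [Fintype S] [Fintype A]
    (P : S → A → S → ℝ)
    (hP0 : ∀ s a s', 0 ≤ P s a s') (hP1 : ∀ s a, ∑ s' : S, P s a s' = 1)
    (s : S) (a : A) (π : S → A) (hπ : π s = a) (d : ℕ) (hd : 1 ≤ d) :
    (1 / 2 : ℝ) ≤
      ∑ t : Fin d → S,
        (if (1 / 4 : ℝ) * expVisits P π (fun s' => if s' = s then 1 else 0) s a d ≤
              (visitCount π s a d t : ℝ) then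
          trajProb P π (fun s' => if s' = s then 1 else 0) d t
        else 0) := by
  set b : S → ℕ := fun x => if x = s ∧ π x = a then 1 else 0 with hb
  have hQ0 : ∀ x y, 0 ≤ P x (π x) y := fun x y => hP0 _ _ _
  have hQ1 : ∀ x, ∑ y, P x (π x) y = 1 := fun x => hP1 _ _
  have key (f : ℕ → ℝ) : ∑ t : Fin d → S,
      trajProb P π (fun s' => if s' = s then 1 else 0) d t * f (visitCount π s a d t) =
        chainExp (fun x => P x (π x)) b d s f := by
    rw [sum_trajProb_mul P hP1 π s a d _ (by simp)]
    simp [hb]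
  have hW : expVisits P π (fun s' => if s' = s then 1 else 0) s a d =
      chainExp (fun x => P x (π x)) b d s (fun n => (n : ℝ)) := key _
  set W := expVisits P π (fun s' => if s' = s then 1 else 0) s a d
  have hsum := key fun n => if 1 / 4 * W ≤ n then 1 else 0
  simp only [mul_ite, mul_one, mul_zero] at hsum
  rw [hsum]
  simp only [← Nat.ceil_le]
  rcases hm : ⌈1 / 4 * W⌉₊ with _ | k
  · simp only [Nat.zero_le, if_true, chainExp_const b hQ1]
    norm_num
  · have hk : (k : ℝ) < 1 / 4 * W := Nat.lt_ceil.mp (by omega)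
    have hexcess := chainExp_sub_le b hQ0 hQ1 (s := s)
      (fun x => by by_cases h : x = s ∧ π x = a <;> simp [hb, h, hπ]) d W hW.ge k s
    have hsplit : W ≤ k + chainExp (fun x => P x (π x)) b d s (fun n => ((n - k : ℕ) : ℝ)) := by
      calc W ≤ chainExp (fun x => P x (π x)) b d s (fun n => (k : ℝ) + ((n - k : ℕ) : ℝ)) := by
            rw [hW]
            exact chainExp_mono b hQ0 d s fun n => by exact_mod_cast (by omega : n ≤ k + (n - k))
        _ = _ := by rw [chainExp_add, chainExp_const b hQ1]
    have hk0 : (0 : ℝ) ≤ k := k.cast_nonneg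
    by_contra! hp
    nlinarith
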